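/- Let V₁, …, V_L be finite nonempty subsets of ℝ^n, let R_ℓ = convexHull(V_ℓ) for each ℓ, and let q = ⋃_{ℓ=1}^{L} R_ℓ. Let h : ℝ^n → ℝ^k be a function such that h_j(x) ≥ 0 for all x ∈ q and all j, and such that h restricted to each R_ℓ is affine (i.e., for each ℓ there exist A_ℓ ∈ ℝ^{k×n} and c_ℓ ∈ ℝ^k with h(x) = A_ℓ x + c_ℓ for all x ∈ R_ℓ). Let W, Ŵ ∈ ℝ^{m×k} and b, b̂ ∈ ℝ^m. Then sup_{x ∈ q} ‖(Ŵ h(x) + b̂) − (W h(x) + b)‖₁ ≤ max_{x ∈ V₁ ∪ ⋯ ∪ V_L} ( Σ_{i=1}^{m} Σ_{j=1}^{k} |Ŵ_{ij} − W_{ij}| h_j(x) + Σ_{i=1}^{m} |b̂_i − b_i| ). -/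

import Mathlib

/-- A weighted sum of the coordinates of an affine map that is bounded on a set is bounded, by the
same constant, on its convex hull. -/
theorem sum_mul_affine_le_of_mem_convexHull {n k : ℕ} {S : Set (Fin n → ℝ)}
    (A : Matrix (Fin k) (Fin n) ℝ) (c d : Fin k → ℝ) {M : ℝ}
    (hS : ∀ v ∈ S, ∑ j, d j * (A.mulVec v + c) j ≤ M)
    {x : Fin n → ℝ} (hx : x ∈ convexHull ℝ S) :
    ∑ j, d j * (A.mulVec x + c) j ≤ M := by
  have hsplit (v : Fin n → ℝ) : ∑ j, d j * (A.mulVec v + c) j =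
      (∑ j, d j • (LinearMap.proj j ∘ₗ A.mulVecLin)) v + ∑ j, d j * c j := by
    simp [mul_add, Finset.sum_add_distrib]
  have hconv := convex_halfSpace_le
    (∑ j, d j • (LinearMap.proj j ∘ₗ A.mulVecLin) : (Fin n → ℝ) →ₗ[ℝ] ℝ).isLinear
    (M - ∑ j, d j * c j)
  have hmem := convexHull_min (fun v hv => ?_) hconv hx
  · rw [hsplit]
    exact le_sub_iff_add_le.mp hmem
  · exact le_sub_iff_add_le.mpr (hsplit v ▸ hS v hv)

/-- Two affine maps evaluated at the same nonnegative vector differ in 1-norm by at most the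
correspondingly weighted sum of the entrywise differences of their parameters. -/
theorem sum_abs_affine_sub_le {k m : ℕ} (W What : Matrix (Fin m) (Fin k) ℝ) (b bhat : Fin m → ℝ)
    {y : Fin k → ℝ} (hy : ∀ j, 0 ≤ y j) :
    ∑ i, |(What.mulVec y + bhat) i - (W.mulVec y + b) i| ≤
      (∑ i, ∑ j, |What i j - W i j| * y j) + ∑ i, |bhat i - b i| := by
  rw [← Finset.sum_add_distrib]
  refine Finset.sum_le_sum fun i _ => ?_
  have heq : (What.mulVec y + bhat) i - (W.mulVec y + b) i =
      (∑ j, (What i j - W i j) * y j) + (bhat i - b i) := by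
    simp only [Pi.add_apply, Matrix.mulVec, dotProduct, sub_mul, Finset.sum_sub_distrib]
    ring
  rw [heq]
  refine (abs_add_le _ _).trans (add_le_add_left ((Finset.abs_sum_le_sum_abs _ _).trans ?_) _)
  exact Finset.sum_le_sum fun j _ => by rw [abs_mul, abs_of_nonneg (hy j)]

theorem stmt1 {n k m L : ℕ} (hL : 0 < L)
    (V : Fin L → Finset (Fin n → ℝ)) (hV : ∀ ℓ, (V ℓ).Nonempty)
    (R : Fin L → Set (Fin n → ℝ))
    (hR : ∀ ℓ, R ℓ = convexHull ℝ ((V ℓ : Set (Fin n → ℝ))))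
    (q : Set (Fin n → ℝ)) (hq : q = ⋃ ℓ, R ℓ)
    (h : (Fin n → ℝ) → (Fin k → ℝ))
    (hpos : ∀ x ∈ q, ∀ j, 0 ≤ h x j)
    (haff : ∀ ℓ, ∃ (A : Matrix (Fin k) (Fin n) ℝ) (c : Fin k → ℝ),
        ∀ x ∈ R ℓ, h x = A.mulVec x + c)
    (W What : Matrix (Fin m) (Fin k) ℝ) (b bhat : Fin m → ℝ)
    (verts : Finset (Fin n → ℝ)) (hverts : verts = Finset.univ.biUnion V)
    (hne : verts.Nonempty) :
    ∀ x ∈ q,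
      ∑ i, |(What.mulVec (h x) + bhat) i - (W.mulVec (h x) + b) i| ≤
        verts.sup' hne (fun v =>
          (∑ i, ∑ j, |What i j - W i j| * h v j) + ∑ i, |bhat i - b i|) := by
  intro x hx
  refine (sum_abs_affine_sub_le W What b bhat (hpos x hx)).trans ?_
  rw [hq] at hx
  obtain ⟨ℓ, hxℓ⟩ := Set.mem_iUnion.mp hx
  obtain ⟨A, c, hA⟩ := haff ℓ
  have hcomm (y : Fin k → ℝ) : ∑ i, ∑ j, |What i j - W i j| * y j =
      ∑ j, (∑ i, |What i j - W i j|) * y j := by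
    rw [Finset.sum_comm]
    simp only [Finset.sum_mul]
  rw [← le_sub_iff_add_le, hcomm, hA x hxℓ]
  refine sum_mul_affine_le_of_mem_convexHull A c _ (fun v hv => ?_) (hR ℓ ▸ hxℓ)
  have hvR : v ∈ R ℓ := hR ℓ ▸ subset_convexHull ℝ _ hv
  have hvV : v ∈ verts := by
    rw [hverts]
    exact Finset.mem_biUnion.mpr ⟨ℓ, Finset.mem_univ ℓ, hv⟩
  rw [← hA v hvR, ← hcomm, le_sub_iff_add_le]
  exact Finset.le_sup' (fun v =>
    (∑ i, ∑ j, |What i j - W i j| * h v j) + ∑ i, |bhat i - b i|) hvV
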